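/- Mean convergence of the empirical density: let γ : ℝ → ℝ≥0 be continuous with compact support, t > 0, and H : ℝ → ℝ continuous with compact support. Then lim_{n→∞} (1/n) Σ_{k∈ℤ} H(k/n) B(k, ⌊tn⌋) = ∫_ℝ H(x) ρ(t, x) dx, where B(j, m) := Σ_{k∈ℤ} γ(k/n) p_m(k, j) and ρ(t, x) = (γ * f_t)(x). -/

import Mathlib

open Filter
open scoped ENNReal Topology

noncomputable section

/-- The state space `ℓ²(ℤ; ℂ²)` of the Hadamard quantum walk. -/
abbrev QWState : Type := lp (fun _ : ℤ => EuclideanSpace ℂ (Fin 2)) 2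

/-- The walk started at site `k` with pure coin state `c`
(`c = 0` is the coin `+`, `c = 1` is the coin `−`): the unit vector `δ_k ⊗ c`. -/
def deltaCoin (k : ℤ) (c : Fin 2) : QWState := lp.single 2 k (EuclideanSpace.single c 1)

/-- The Konno density: `f(x) = 1/(π(1−x²)√(1−2x²))` for `|x| < 1/√2`, and `0` otherwise. -/
def konno (x : ℝ) : ℝ :=
  if |x| < 1 / Real.sqrt 2 then 1 / (Real.pi * (1 - x ^ 2) * Real.sqrt (1 - 2 * x ^ 2)) else 0

/-- The component `b` at site `j` of the walk after `m` steps, started at the origin in the pure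
coin state `c`. -/
def amplitude (c : Fin 2) : ℕ → ℤ → Fin 2 → ℂ
  | 0, j, b => if j = 0 ∧ b = c then 1 else 0
  | m + 1, j, b =>
    if b = 0 then (amplitude c m (j - 1) 0 + amplitude c m (j - 1) 1) / (Real.sqrt 2 : ℂ)
    else (amplitude c m (j + 1) 0 - amplitude c m (j + 1) 1) / (Real.sqrt 2 : ℂ)

/-- The coin-averaged probability of a displacement `d` in `m` steps. -/
def walkProb (m : ℕ) (d : ℤ) : ℝ :=
  (1 / 2) * ∑ c : Fin 2, ∑ b : Fin 2, ‖amplitude c m d b‖ ^ 2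

lemma walkProb_nonneg (m : ℕ) (d : ℤ) : 0 ≤ walkProb m d := by
  unfold walkProb; positivity

lemma pow_deltaCoin_apply {U : QWState →ₗ[ℂ] QWState}
    (hU : ∀ (ψ : QWState) (k : ℤ),
      (U ψ) k 0 = (ψ (k - 1) 0 + ψ (k - 1) 1) / (Real.sqrt 2 : ℂ) ∧
      (U ψ) k 1 = (ψ (k + 1) 0 - ψ (k + 1) 1) / (Real.sqrt 2 : ℂ))
    (m : ℕ) (k j : ℤ) (c b : Fin 2) :
    ((U ^ m) (deltaCoin k c)) j b = amplitude c m (j - k) b := by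
  induction m generalizing j b with
  | zero =>
    by_cases hj : j = k
    · subst hj
      simp [deltaCoin, amplitude]
    · simp [deltaCoin, amplitude, hj, sub_eq_zero, lp.single_apply]
  | succ m ih =>
    rw [pow_succ', Module.End.mul_apply]
    have h := hU ((U ^ m) (deltaCoin k c)) j
    have e1 : j - k - 1 = j - 1 - k := by ring
    have e2 : j - k + 1 = j + 1 - k := by ring
    fin_cases b
    · simpa [amplitude, ih, e1] using h.1
    · simpa [amplitude, ih, e2] using h.2

lemma transition_eq_walkProb {U : QWState →ₗ[ℂ] QWState}
    (hU : ∀ (ψ : QWState) (k : ℤ),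
      (U ψ) k 0 = (ψ (k - 1) 0 + ψ (k - 1) 1) / (Real.sqrt 2 : ℂ) ∧
      (U ψ) k 1 = (ψ (k + 1) 0 - ψ (k + 1) 1) / (Real.sqrt 2 : ℂ))
    (m : ℕ) (k j : ℤ) :
    (1 / 2) * ‖((U ^ m) (deltaCoin k 0)) j‖ ^ 2
        + (1 / 2) * ‖((U ^ m) (deltaCoin k 1)) j‖ ^ 2 = walkProb m (j - k) := by
  simp only [EuclideanSpace.norm_sq_eq, pow_deltaCoin_apply hU, walkProb, Fin.sum_univ_two]
  ring

lemma amplitude_eq_zero (c : Fin 2) (m : ℕ) (j : ℤ) (hj : (m : ℤ) < |j|) (b : Fin 2) :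
    amplitude c m j b = 0 := by
  induction m generalizing j b with
  | zero =>
    have : j ≠ 0 := by rintro rfl; simp at hj
    simp [amplitude, this]
  | succ m ih =>
    push_cast at hj
    have h1 : (m : ℤ) < |j - 1| := by rw [lt_abs] at *; omega
    have h2 : (m : ℤ) < |j + 1| := by rw [lt_abs] at *; omega
    simp [amplitude, ih _ h1, ih _ h2]

lemma notMem_Icc_iff_lt_abs {m : ℕ} {j : ℤ} :
    j ∉ Finset.Icc (-(m : ℤ)) m ↔ (m : ℤ) < |j| := by
  rw [Finset.mem_Icc, ← abs_le, not_le]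

lemma walkProb_eq_zero {m : ℕ} {d : ℤ} (hd : d ∉ Finset.Icc (-(m : ℤ)) m) : walkProb m d = 0 := by
  simp [walkProb, amplitude_eq_zero _ m d (notMem_Icc_iff_lt_abs.1 hd)]

/-- The phase of the walk: up to the factor `-i`, the one-step operator at momentum `k` is an
element of `SU(2)` with eigenvalues `exp (± i phase k)`. -/
def phase (k : ℝ) : ℝ := Real.arccos (-Real.sin k / Real.sqrt 2)

lemma abs_neg_sin_div_sqrt_two_lt (k : ℝ) : |-Real.sin k / Real.sqrt 2| < 1 := by
  rw [abs_div, abs_neg, abs_of_pos (by positivity : (0 : ℝ) < Real.sqrt 2),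
    div_lt_one (by positivity)]
  exact (Real.abs_sin_le_one k).trans_lt Real.one_lt_sqrt_two

lemma cos_phase (k : ℝ) : Real.cos (phase k) = -Real.sin k / Real.sqrt 2 := by
  have h := abs_lt.1 (abs_neg_sin_div_sqrt_two_lt k)
  exact Real.cos_arccos h.1.le h.2.le

lemma sin_phase_sq (k : ℝ) : Real.sin (phase k) ^ 2 = 1 - Real.sin k ^ 2 / 2 := by
  rw [Real.sin_sq, cos_phase, div_pow, Real.sq_sqrt (by norm_num)]
  ring

lemma sin_phase_pos (k : ℝ) : 0 < Real.sin (phase k) := by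
  have h0 : 0 ≤ Real.sin (phase k) :=
    Real.sin_nonneg_of_nonneg_of_le_pi (Real.arccos_nonneg _) (Real.arccos_le_pi _)
  refine h0.lt_of_ne' fun h ↦ ?_
  have := sin_phase_sq k
  rw [h] at this
  nlinarith [Real.sin_sq_le_one k]

/-- The one-step operator at momentum `k`, multiplied by `i`. -/
def momentumStep (k : ℝ) (b c : Fin 2) : ℂ :=
  Complex.I / (Real.sqrt 2 : ℂ) *
    (if b = 0 then Complex.exp (k * Complex.I)
      else if c = 0 then Complex.exp (-(k * Complex.I)) else -Complex.exp (-(k * Complex.I)))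

/-- The `m`-step operator at momentum `k`, in closed form. -/
def momentumAmplitude (m : ℕ) (k : ℝ) (b c : Fin 2) : ℂ :=
  (-Complex.I) ^ m * ((Real.cos (m * phase k) : ℂ) * (if b = c then 1 else 0) +
    (Real.sin (m * phase k) / Real.sin (phase k) : ℂ) *
      (momentumStep k b c - (Real.cos (phase k) : ℂ) * (if b = c then 1 else 0)))

lemma I_div_sqrt_two_sq : (Complex.I / (Real.sqrt 2 : ℂ)) ^ 2 = -1 / 2 := by
  rw [div_pow, Complex.I_sq, ← Complex.ofReal_pow, Real.sq_sqrt (by norm_num)]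
  norm_num

lemma two_mul_cos_phase (k : ℝ) :
    2 * (Real.cos (phase k) : ℂ) = Complex.I / (Real.sqrt 2 : ℂ) *
      (Complex.exp (k * Complex.I) - Complex.exp (-(k * Complex.I))) := by
  rw [cos_phase, Complex.exp_mul_I, ← neg_mul, Complex.exp_mul_I, Complex.cos_neg, Complex.sin_neg]
  push_cast
  linear_combination (-2 * Complex.sin k / (Real.sqrt 2 : ℂ)) * Complex.I_sq

lemma exp_mul_exp_neg (z : ℂ) : Complex.exp z * Complex.exp (-z) = 1 := by
  rw [← Complex.exp_add, add_neg_cancel, Complex.exp_zero]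

lemma momentumAmplitude_succ (m : ℕ) (k : ℝ) (c : Fin 2) :
    momentumAmplitude (m + 1) k 0 c = Complex.exp (k * Complex.I) *
      (momentumAmplitude m k 0 c + momentumAmplitude m k 1 c) / (Real.sqrt 2 : ℂ) ∧
    momentumAmplitude (m + 1) k 1 c = Complex.exp (-(k * Complex.I)) *
      (momentumAmplitude m k 0 c - momentumAmplitude m k 1 c) / (Real.sqrt 2 : ℂ) := by
  have hs : (Real.sin (phase k) : ℂ) ≠ 0 := by exact_mod_cast (sin_phase_pos k).ne'
  have hsc : (Real.sin (phase k) : ℂ) ^ 2 + (Real.cos (phase k) : ℂ) ^ 2 = 1 := by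
    exact_mod_cast Real.sin_sq_add_cos_sq (phase k)
  have hC : (Real.cos ((m + 1 : ℕ) * phase k) : ℂ) =
      Real.cos (m * phase k) * Real.cos (phase k) - Real.sin (m * phase k) * Real.sin (phase k) := by
    push_cast; rw [add_mul, one_mul, Complex.cos_add]
  have hS : (Real.sin ((m + 1 : ℕ) * phase k) : ℂ) =
      Real.sin (m * phase k) * Real.cos (phase k) + Real.cos (m * phase k) * Real.sin (phase k) := by
    push_cast; rw [add_mul, one_mul, Complex.sin_add]
  obtain ⟨σ, hσ⟩ : ∃ σ : ℂ, (Real.sin (m * phase k) : ℂ) = σ * Real.sin (phase k) :=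
    ⟨_, (div_mul_cancel₀ _ hs).symm⟩
  have hS' : (Real.sin ((m + 1 : ℕ) * phase k) : ℂ) / Real.sin (phase k) =
      σ * Real.cos (phase k) + Real.cos (m * phase k) := by
    rw [hS, hσ]; field_simp
  have hσ' : (Real.sin (m * phase k) : ℂ) / Real.sin (phase k) = σ := by
    rw [hσ]; field_simp
  have h2 := two_mul_cos_phase k
  have hu := I_div_sqrt_two_sq
  have he := exp_mul_exp_neg (k * Complex.I)
  have hr : (Real.sqrt 2 : ℂ)⁻¹ = -Complex.I * (Complex.I / (Real.sqrt 2 : ℂ)) := by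
    linear_combination (Real.sqrt 2 : ℂ)⁻¹ * Complex.I_sq
  simp only [momentumAmplitude, momentumStep, hS', hσ', hC, div_eq_mul_inv _ (Real.sqrt 2 : ℂ),
    pow_succ]
  rw [hσ]
  rw [div_eq_mul_inv] at h2 hu hr
  clear hS hσ hσ' hC hS' hs
  generalize Complex.I * (Real.sqrt 2 : ℂ)⁻¹ = u at *
  rw [hr]
  clear hr
  generalize Complex.exp (k * Complex.I) = e at *
  generalize Complex.exp (-(k * Complex.I)) = e' at *
  generalize (Real.cos (phase k) : ℂ) = x at *
  generalize (Real.sin (phase k) : ℂ) = y at *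
  generalize (Real.cos (m * phase k) : ℂ) = C at *
  generalize (-Complex.I) ^ m = P at *
  generalize -Complex.I = Q at *
  fin_cases c <;> simp <;> constructor
  · linear_combination (-P * Q * σ) * (-u * e * h2 + 2 * u ^ 2 * he + 2 * hu + hsc)
  · linear_combination (P * Q * σ * u * e') * h2
  · linear_combination (P * Q * σ * u * e) * h2
  · linear_combination (-P * Q * σ) * (u * e' * h2 + 2 * u ^ 2 * he + 2 * hu + hsc)

lemma hasSum_amplitude_mul_exp (m : ℕ) (k : ℝ) (b c : Fin 2) :
    HasSum (fun j : ℤ ↦ amplitude c m j b * Complex.exp (j * (k * Complex.I)))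
      (momentumAmplitude m k b c) := by
  induction m generalizing b with
  | zero =>
    have h := hasSum_single (f := fun j : ℤ ↦ amplitude c 0 j b *
      Complex.exp (j * (k * Complex.I))) 0 fun j hj ↦ by simp [amplitude, hj]
    convert! h using 1
    simp [amplitude, momentumAmplitude]
  | succ m ih =>
    have h1 (b : Fin 2) : HasSum (fun j : ℤ ↦ amplitude c m (j - 1) b *
        Complex.exp (j * (k * Complex.I)))
        (momentumAmplitude m k b c * Complex.exp (k * Complex.I)) := by
      convert! ((Equiv.subRight (1 : ℤ)).hasSum_iff.2 (ih b)).mul_right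
        (Complex.exp (k * Complex.I)) using 2 with j
      simp only [Function.comp_apply, Equiv.subRight_apply, mul_assoc, ← Complex.exp_add]
      congr 2
      push_cast
      ring
    have h2 (b : Fin 2) : HasSum (fun j : ℤ ↦ amplitude c m (j + 1) b *
        Complex.exp (j * (k * Complex.I)))
        (momentumAmplitude m k b c * Complex.exp (-(k * Complex.I))) := by
      convert! ((Equiv.addRight (1 : ℤ)).hasSum_iff.2 (ih b)).mul_right
        (Complex.exp (-(k * Complex.I))) using 2 with j
      simp only [Function.comp_apply, Equiv.coe_addRight, mul_assoc, ← Complex.exp_add]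
      congr 2
      push_cast
      ring
    obtain ⟨r0, r1⟩ := momentumAmplitude_succ m k c
    fin_cases b
    · convert! ((h1 0).add (h1 1)).div_const (Real.sqrt 2 : ℂ) using 1
      · ext j; simp [amplitude]; ring
      · refine r0.trans ?_; ring
    · convert! ((h2 0).sub (h2 1)).div_const (Real.sqrt 2 : ℂ) using 1
      · ext j; simp [amplitude]; ring
      · refine r1.trans ?_; ring

lemma sum_amplitude_mul_exp (m : ℕ) (k : ℝ) (b c : Fin 2) :
    ∑ j ∈ Finset.Icc (-(m : ℤ)) m, amplitude c m j b * Complex.exp (j * (k * Complex.I)) =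
      momentumAmplitude m k b c :=
  (hasSum_sum_of_ne_finset_zero fun j hj ↦ by
    rw [amplitude_eq_zero c m j (notMem_Icc_iff_lt_abs.1 hj), zero_mul]).unique
    (hasSum_amplitude_mul_exp m k b c)

lemma integral_exp_int_mul (d : ℤ) :
    ∫ k in (-Real.pi)..Real.pi, Complex.exp (d * (k * Complex.I)) =
      if d = 0 then 2 * (Real.pi : ℂ) else 0 := by
  split_ifs with hd
  · subst hd
    simp; ring
  · have hc : (d * Complex.I : ℂ) ≠ 0 := by simp [hd]
    have h := integral_exp_mul_complex (a := -Real.pi) (b := Real.pi) hc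
    have e (k : ℝ) : (d * (k * Complex.I) : ℂ) = d * Complex.I * k := by ring
    simp only [e, h, div_eq_zero_iff, hc, or_false, sub_eq_zero]
    rw [Complex.exp_eq_exp_iff_exists_int]
    exact ⟨d, by push_cast; ring⟩

/-- Parseval's identity for a trigonometric polynomial and its translate. -/
lemma integral_conj_mul_translate (s : Finset ℤ) (a : ℤ → ℂ) (h : ℝ) :
    ∫ k in (-Real.pi)..Real.pi,
      (starRingEnd ℂ) (∑ j ∈ s, a j * Complex.exp (j * (k * Complex.I))) *
        ∑ j ∈ s, a j * Complex.exp (j * ((k + h : ℝ) * Complex.I)) =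
      2 * Real.pi * ∑ j ∈ s, (‖a j‖ ^ 2 : ℝ) * Complex.exp (j * (h * Complex.I)) := by
  have e (k : ℝ) : (starRingEnd ℂ) (∑ j ∈ s, a j * Complex.exp (j * (k * Complex.I))) *
        ∑ j ∈ s, a j * Complex.exp (j * ((k + h : ℝ) * Complex.I)) =
      ∑ i ∈ s, ∑ j ∈ s, ((starRingEnd ℂ) (a i) * a j * Complex.exp (j * (h * Complex.I))) *
        Complex.exp (((j - i : ℤ) : ℂ) * (k * Complex.I)) := by
    rw [map_sum, Finset.sum_mul_sum]
    refine Finset.sum_congr rfl fun i _ ↦ Finset.sum_congr rfl fun j _ ↦ ?_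
    have h1 : (starRingEnd ℂ) (Complex.exp (i * (k * Complex.I))) =
        Complex.exp (-(i * (k * Complex.I))) := by
      rw [← Complex.exp_conj]; simp
    have h2 : Complex.exp (-(i * (k * Complex.I))) *
        Complex.exp (j * ((k + h : ℝ) * Complex.I)) = Complex.exp (j * (h * Complex.I)) *
          Complex.exp (((j - i : ℤ) : ℂ) * (k * Complex.I)) := by
      rw [← Complex.exp_add, ← Complex.exp_add]
      congr 1
      push_cast
      ring
    rw [map_mul, h1]
    linear_combination ((starRingEnd ℂ) (a i) * a j) * h2
  simp only [e]
  rw [intervalIntegral.integral_finsetSum fun i _ ↦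
    Continuous.intervalIntegrable (by fun_prop) _ _, Finset.mul_sum]
  refine Finset.sum_congr rfl fun i hi ↦ ?_
  rw [intervalIntegral.integral_finsetSum fun i _ ↦
    Continuous.intervalIntegrable (by fun_prop) _ _]
  simp only [intervalIntegral.integral_const_mul, integral_exp_int_mul, sub_eq_zero, mul_ite,
    mul_zero]
  rw [Finset.sum_ite_eq_of_mem' _ _ _ hi]
  push_cast
  rw [← Complex.conj_mul']
  ring

/-- Normalized overlap of the rotation axes of the one-step operators at momenta `k` and `k'`. -/
def axisOverlap (k k' : ℝ) : ℝ :=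
  (Real.cos (k' - k) - Real.cos (phase k) * Real.cos (phase k')) /
    (Real.sin (phase k) * Real.sin (phase k'))

/-- Half the trace of the product of the adjoint of the `m`-step operator at momentum `k`
with the `m`-step operator at momentum `k'`. -/
def traceKernel (m : ℕ) (k k' : ℝ) : ℝ :=
  Real.cos (m * phase k) * Real.cos (m * phase k') +
    Real.sin (m * phase k) * Real.sin (m * phase k') * axisOverlap k k'

lemma sum_conj_momentumAmplitude_mul (m : ℕ) (k k' : ℝ) :
    ∑ c : Fin 2, ∑ b : Fin 2,
      (starRingEnd ℂ) (momentumAmplitude m k b c) * momentumAmplitude m k' b c =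
      2 * (traceKernel m k k' : ℂ) := by
  have hs : (Real.sin (phase k) : ℂ) ≠ 0 := by exact_mod_cast (sin_phase_pos k).ne'
  have hs' : (Real.sin (phase k') : ℂ) ≠ 0 := by exact_mod_cast (sin_phase_pos k').ne'
  have hcos : 2 * (Real.cos (k' - k) : ℂ) =
      Complex.exp (-(k * Complex.I)) * Complex.exp (k' * Complex.I) +
        Complex.exp (k * Complex.I) * Complex.exp (-(k' * Complex.I)) := by
    rw [Complex.ofReal_cos, Complex.two_cos, ← Complex.exp_add, ← Complex.exp_add]
    congr 2 <;> · push_cast; ring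
  have hP : (starRingEnd ℂ) ((-Complex.I) ^ m) * (-Complex.I) ^ m = 1 := by
    rw [Complex.conj_mul']
    simp
  have h1 : (starRingEnd ℂ) (Complex.exp (k * Complex.I)) = Complex.exp (-(k * Complex.I)) := by
    rw [← Complex.exp_conj]; simp
  have h1' : (starRingEnd ℂ) (Complex.exp (-(k * Complex.I))) = Complex.exp (k * Complex.I) := by
    rw [← Complex.exp_conj]; simp
  have hu := I_div_sqrt_two_sq
  have hcu : (starRingEnd ℂ) (Complex.I / (Real.sqrt 2 : ℂ)) = -(Complex.I / (Real.sqrt 2 : ℂ)) := by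
    rw [map_div₀, Complex.conj_I, Complex.conj_ofReal, neg_div]
  have h2 := two_mul_cos_phase k
  have h2' := two_mul_cos_phase k'
  have hT : (traceKernel m k k' : ℂ) =
      Real.cos (m * phase k) * Real.cos (m * phase k') +
      (Real.sin (m * phase k) / Real.sin (phase k)) *
        (Real.sin (m * phase k') / Real.sin (phase k')) *
        (Real.cos (k' - k) - Real.cos (phase k) * Real.cos (phase k')) := by
    rw [traceKernel, axisOverlap]
    simp only [Complex.ofReal_add, Complex.ofReal_mul, Complex.ofReal_div, Complex.ofReal_sub]
    field_simp
  rw [hT]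
  simp only [Fin.sum_univ_two, momentumAmplitude, momentumStep, map_mul, map_add, map_sub,
    map_div₀ (starRingEnd ℂ) (Real.sin _ : ℂ), Complex.conj_ofReal, hcu]
  simp [-Complex.ofReal_cos, -Complex.ofReal_sin, h1, h1', -map_div₀]
  rw [map_pow, map_neg, Complex.conj_I, neg_neg] at hP
  generalize (Real.sin (m * phase k) / Real.sin (phase k) : ℂ) = σ at *
  generalize (Real.sin (m * phase k') / Real.sin (phase k') : ℂ) = σ' at *
  generalize (Complex.I / (Real.sqrt 2 : ℂ)) = u at *
  generalize Complex.exp (k * Complex.I) = e at *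
  generalize Complex.exp (-(k * Complex.I)) = e' at *
  generalize Complex.exp (k' * Complex.I) = f at *
  generalize Complex.exp (-(k' * Complex.I)) = f' at *
  generalize (Real.cos (phase k) : ℂ) = x at *
  generalize (Real.cos (phase k') : ℂ) = x' at *
  generalize (Real.cos (k' - k) : ℂ) = w at *
  generalize (Real.cos (m * phase k) : ℂ) = C at *
  generalize (Real.cos (m * phase k') : ℂ) = C' at *
  generalize (-Complex.I) ^ m = P at *
  generalize Complex.I ^ m = Q at *
  linear_combination ((C + σ * (-(u * e') - x)) * (C' + σ' * (u * f - x')) - σ * u * e * σ' * u * f'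
    - σ * u * e' * σ' * u * f + (C + σ * (u * e - x)) * (C' + σ' * (-(u * f') - x'))) * hP
    - C * σ' * h2' - σ * C' * h2
    + σ * σ' * (-2 * (e' * f + e * f') * hu - hcos + x' * h2 + x * h2')

lemma continuous_phase : Continuous phase := by
  unfold phase
  fun_prop

lemma continuous_traceKernel (m : ℕ) (h : ℝ) : Continuous fun k ↦ traceKernel m k (k + h) := by
  have := continuous_phase
  unfold traceKernel axisOverlap
  refine Continuous.add (by fun_prop) (Continuous.mul (by fun_prop) (Continuous.div (by fun_prop)
    (by fun_prop) fun k ↦ ?_))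
  exact (mul_pos (sin_phase_pos _) (sin_phase_pos _)).ne'

lemma sum_walkProb_mul_exp (m : ℕ) (h : ℝ) :
    ∑ d ∈ Finset.Icc (-(m : ℤ)) m, (walkProb m d : ℂ) * Complex.exp (d * (h * Complex.I)) =
      ((1 / (2 * Real.pi) * ∫ k in (-Real.pi)..Real.pi, traceKernel m k (k + h) : ℝ) : ℂ) := by
  have hpi : (Real.pi : ℂ) ≠ 0 := by exact_mod_cast Real.pi_ne_zero
  have hE (b c : Fin 2) : Continuous fun k ↦ momentumAmplitude m k b c := by
    simp only [← sum_amplitude_mul_exp]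
    fun_prop
  have h1 := fun b c ↦ integral_conj_mul_translate (Finset.Icc (-(m : ℤ)) m)
    (fun j ↦ amplitude c m j b) h
  simp only [sum_amplitude_mul_exp] at h1
  have h2 : ∫ k in (-Real.pi)..Real.pi, (2 * (traceKernel m k (k + h) : ℂ)) =
      ∑ c : Fin 2, ∑ b : Fin 2, (2 * Real.pi * ∑ j ∈ Finset.Icc (-(m : ℤ)) m,
        (‖amplitude c m j b‖ ^ 2 : ℝ) * Complex.exp (j * (h * Complex.I))) := by
    simp only [← sum_conj_momentumAmplitude_mul, ← h1]
    have hc (b c : Fin 2) : Continuous fun k ↦ (starRingEnd ℂ) (momentumAmplitude m k b c) *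
        momentumAmplitude m (k + h) b c :=
      (Complex.continuous_conj.comp (hE b c)).mul ((hE b c).comp (by fun_prop))
    rw [intervalIntegral.integral_finsetSum fun c _ ↦
      (continuous_finsetSum _ fun b _ ↦ hc b c).intervalIntegrable _ _]
    exact Finset.sum_congr rfl fun c _ ↦ intervalIntegral.integral_finsetSum fun b _ ↦
      (hc b c).intervalIntegrable _ _
  rw [intervalIntegral.integral_const_mul, intervalIntegral.integral_ofReal] at h2
  have h3 : ∑ d ∈ Finset.Icc (-(m : ℤ)) m,
      (walkProb m d : ℂ) * Complex.exp (d * (h * Complex.I)) =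
      1 / (4 * Real.pi) * ∑ c : Fin 2, ∑ b : Fin 2,
        (2 * Real.pi * ∑ j ∈ Finset.Icc (-(m : ℤ)) m,
        (‖amplitude c m j b‖ ^ 2 : ℝ) * Complex.exp (j * (h * Complex.I))) := by
    simp only [Fin.sum_univ_two, ← mul_add, ← Finset.sum_add_distrib, ← add_mul, Finset.mul_sum]
    refine Finset.sum_congr rfl fun d _ ↦ ?_
    simp only [walkProb, Fin.sum_univ_two]
    push_cast
    field_simp
    ring
  rw [h3, ← h2]
  push_cast
  field_simp
  ring

lemma axisOverlap_self (k : ℝ) : axisOverlap k k = 1 := by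
  have := (sin_phase_pos k).ne'
  rw [axisOverlap, sub_self, Real.cos_zero, div_eq_one_iff_eq (by positivity)]
  linarith [Real.sin_sq_add_cos_sq (phase k)]

lemma traceKernel_self (m : ℕ) (k : ℝ) : traceKernel m k k = 1 := by
  rw [traceKernel, axisOverlap_self]
  linarith [Real.sin_sq_add_cos_sq (m * phase k)]

lemma sum_walkProb (m : ℕ) : ∑ d ∈ Finset.Icc (-(m : ℤ)) m, walkProb m d = 1 := by
  have h := sum_walkProb_mul_exp m 0
  simp only [Complex.ofReal_zero, zero_mul, mul_zero, Complex.exp_zero, mul_one, add_zero,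
    traceKernel_self, intervalIntegral.integral_const] at h
  have hr : ∑ d ∈ Finset.Icc (-(m : ℤ)) m, walkProb m d =
    1 / (2 * Real.pi) * ((Real.pi - -Real.pi) • 1) := by exact_mod_cast h
  rw [hr, smul_eq_mul]
  field_simp
  ring

lemma abs_traceKernel_le (m : ℕ) (k k' : ℝ) : |traceKernel m k k'| ≤ 6 := by
  have hs (k : ℝ) : 7 / 10 ≤ Real.sin (phase k) := by
    have := sin_phase_sq k
    nlinarith [Real.sin_sq_le_one k, sin_phase_pos k]
  have hmul {x y : ℝ} (hx : |x| ≤ 1) (hy : |y| ≤ 1) : |x * y| ≤ 1 := by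
    rw [abs_mul]
    exact mul_le_one₀ hx (abs_nonneg y) hy
  have hw : |axisOverlap k k'| ≤ 5 := by
    have hp := mul_pos (sin_phase_pos k) (sin_phase_pos k')
    rw [axisOverlap, abs_div, abs_of_pos hp, div_le_iff₀ hp]
    have h1 := mul_le_mul (hs k) (hs k') (by norm_num) (sin_phase_pos k).le
    have h2 := abs_sub (Real.cos (k' - k)) (Real.cos (phase k) * Real.cos (phase k'))
    have h3 := hmul (Real.abs_cos_le_one (phase k)) (Real.abs_cos_le_one (phase k'))
    linarith [Real.abs_cos_le_one (k' - k)]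
  have h1 := hmul (Real.abs_cos_le_one (m * phase k)) (Real.abs_cos_le_one (m * phase k'))
  have h2 := hmul (Real.abs_sin_le_one (m * phase k)) (Real.abs_sin_le_one (m * phase k'))
  rw [traceKernel]
  refine (abs_add_le _ _).trans ?_
  rw [abs_mul (_ * _) (axisOverlap k k')]
  nlinarith [abs_nonneg (axisOverlap k k')]

/-- The group velocity of the walk at momentum `k`. -/
def velocity (k : ℝ) : ℝ := Real.cos k / Real.sqrt (1 + Real.cos k ^ 2)

lemma hasDerivAt_phase (k : ℝ) : HasDerivAt phase (velocity k) k := by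
  have h := abs_lt.1 (abs_neg_sin_div_sqrt_two_lt k)
  have h1 : HasDerivAt (fun k ↦ -Real.sin k / Real.sqrt 2) (-Real.cos k / Real.sqrt 2) k :=
    (Real.hasDerivAt_sin k).neg.div_const _
  convert! (Real.hasDerivAt_arccos h.1.ne' h.2.ne).comp k h1 using 1
  have e : 1 - (-Real.sin k / Real.sqrt 2) ^ 2 = (1 + Real.cos k ^ 2) / 2 := by
    rw [div_pow, Real.sq_sqrt (by norm_num), neg_sq, Real.sin_sq]
    ring
  rw [e, Real.sqrt_div (by positivity), velocity]
  have : Real.sqrt (1 + Real.cos k ^ 2) ≠ 0 := by positivity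
  field_simp

lemma continuous_velocity : Continuous velocity := by
  unfold velocity
  exact Continuous.div (by fun_prop) (by fun_prop) fun k ↦ by positivity

lemma tendsto_traceKernel {m : ℕ → ℕ} {t : ℝ}
    (hm : Tendsto (fun n : ℕ ↦ (m n : ℝ) / n) atTop (𝓝 t)) (s k : ℝ) :
    Tendsto (fun n : ℕ ↦ traceKernel (m n) k (k + s / n)) atTop
      (𝓝 (Real.cos (s * (t * velocity k)))) := by
  have h0 : Tendsto (fun n : ℕ ↦ s / (n : ℝ)) atTop (𝓝 0) :=
    tendsto_const_div_atTop_nhds_zero_nat s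
  have hk : Tendsto (fun n : ℕ ↦ k + s / (n : ℝ)) atTop (𝓝 k) := by
    simpa using h0.const_add k
  have hw : Tendsto (fun n : ℕ ↦ axisOverlap k (k + s / n)) atTop (𝓝 1) := by
    have hc : ContinuousAt (axisOverlap k) k := by
      have := continuous_phase
      unfold axisOverlap
      exact ContinuousAt.div (by fun_prop) (by fun_prop)
        (mul_pos (sin_phase_pos _) (sin_phase_pos _)).ne'
    rw [← axisOverlap_self k]
    exact hc.tendsto.comp hk
  have hd : Tendsto (fun n : ℕ ↦ (m n : ℝ) * (phase (k + s / n) - phase k)) atTop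
      (𝓝 (s * (t * velocity k))) := by
    have hg : HasDerivAt (fun u ↦ phase (k + s * u)) (velocity k * s) 0 := by
      have h1 : HasDerivAt (fun u : ℝ ↦ k + s * u) s 0 := by
        simpa using ((hasDerivAt_id (0 : ℝ)).const_mul s).const_add k
      have h2 : HasDerivAt phase (velocity k) (k + s * 0) := by
        simpa using hasDerivAt_phase k
      exact HasDerivAt.comp (h₂ := phase) 0 h2 h1
    have hn : Tendsto (fun n : ℕ ↦ (n : ℝ)⁻¹) atTop (𝓝[≠] 0) :=
      tendsto_nhdsWithin_iff.2 ⟨tendsto_inv_atTop_nhds_zero_nat, by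
        filter_upwards [eventually_ne_atTop 0] with n hn
        simpa using hn⟩
    refine ((hm.mul (hg.tendsto_slope.comp hn)).congr' ?_).trans (le_of_eq (by congr 1; ring))
    filter_upwards [eventually_ne_atTop 0] with n hn
    have : (n : ℝ) ≠ 0 := by exact_mod_cast hn
    simp only [Function.comp_apply, slope_def_field, mul_zero, add_zero, sub_zero, div_eq_mul_inv]
    field_simp
  have e (n : ℕ) : traceKernel (m n) k (k + s / n) =
      Real.cos ((m n : ℝ) * (phase (k + s / n) - phase k)) +
        Real.sin (m n * phase k) * Real.sin (m n * phase (k + s / n)) *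
          (axisOverlap k (k + s / n) - 1) := by
    rw [traceKernel, mul_sub, Real.cos_sub]
    ring
  have hz : Tendsto (fun n : ℕ ↦ Real.sin (m n * phase k) * Real.sin (m n * phase (k + s / n)) *
      (axisOverlap k (k + s / n) - 1)) atTop (𝓝 0) := by
    have hw' : Tendsto (fun n : ℕ ↦ |axisOverlap k (k + s / n) - 1|) atTop (𝓝 0) := by
      simpa using (hw.sub_const 1).abs
    refine squeeze_zero_norm (fun n ↦ ?_) hw'
    rw [Real.norm_eq_abs, abs_mul, abs_mul]
    exact mul_le_of_le_one_left (abs_nonneg _)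
      (mul_le_one₀ (Real.abs_sin_le_one _) (abs_nonneg _) (Real.abs_sin_le_one _))
  simp only [e]
  simpa using ((Real.continuous_cos.tendsto _).comp hd).add hz

section Laws

open MeasureTheory

/-- The law of the displacement after `m` steps, rescaled by `n`. -/
def walkLaw (m n : ℕ) : Measure ℝ :=
  ∑ d ∈ Finset.Icc (-(m : ℤ)) m, ENNReal.ofReal (walkProb m d) • Measure.dirac ((d : ℝ) / n)

lemma integral_walkLaw {E : Type*} [NormedAddCommGroup E] [NormedSpace ℝ E] [CompleteSpace E]
    (m n : ℕ) (f : ℝ → E) :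
    ∫ x, f x ∂(walkLaw m n) = ∑ d ∈ Finset.Icc (-(m : ℤ)) m, walkProb m d • f ((d : ℝ) / n) := by
  rw [walkLaw, integral_finsetSum_measure]
  · simp [integral_smul_measure, ENNReal.toReal_ofReal, walkProb_nonneg]
  · exact fun d _ ↦ (integrable_dirac (by simp)).smul_measure ENNReal.ofReal_ne_top

instance isProbabilityMeasure_walkLaw (m n : ℕ) : IsProbabilityMeasure (walkLaw m n) := by
  constructor
  simp only [walkLaw, Measure.coe_finsetSum, Finset.sum_apply, Measure.smul_apply, measure_univ,
    smul_eq_mul, mul_one]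
  rw [← ENNReal.ofReal_sum_of_nonneg fun d _ ↦ walkProb_nonneg m d, sum_walkProb,
    ENNReal.ofReal_one]

lemma charFun_walkLaw (m n : ℕ) (s : ℝ) :
    charFun (walkLaw m n) s =
      ((1 / (2 * Real.pi) * ∫ k in (-Real.pi)..Real.pi, traceKernel m k (k + s / n) : ℝ) : ℂ) := by
  rw [charFun_apply_real, integral_walkLaw, ← sum_walkProb_mul_exp]
  refine Finset.sum_congr rfl fun d _ ↦ ?_
  rw [Complex.real_smul]
  congr 2
  push_cast
  ring

/-- The law of `t` times the group velocity at a uniformly distributed momentum. -/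
def velocityLaw (t : ℝ) : Measure ℝ :=
  (ENNReal.ofReal (1 / (2 * Real.pi)) • volume.restrict (Set.Ioc (-Real.pi) Real.pi)).map
    fun k ↦ t * velocity k

lemma measurable_mul_velocity (t : ℝ) : Measurable fun k ↦ t * velocity k :=
  (continuous_velocity.const_mul t).measurable

instance isProbabilityMeasure_velocityLaw (t : ℝ) : IsProbabilityMeasure (velocityLaw t) := by
  have : IsProbabilityMeasure
      (ENNReal.ofReal (1 / (2 * Real.pi)) • volume.restrict (Set.Ioc (-Real.pi) Real.pi)) := by
    constructor
    rw [Measure.smul_apply, Measure.restrict_apply_univ, Real.volume_Ioc, smul_eq_mul,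
      ← ENNReal.ofReal_mul (by positivity), ← ENNReal.ofReal_one]
    congr 1
    field_simp
    ring
  exact Measure.isProbabilityMeasure_map (measurable_mul_velocity t).aemeasurable

lemma integral_velocityLaw {E : Type*} [NormedAddCommGroup E] [NormedSpace ℝ E]
    (t : ℝ) {f : ℝ → E} (hf : Continuous f) :
    ∫ x, f x ∂(velocityLaw t) =
      (1 / (2 * Real.pi)) • ∫ k in (-Real.pi)..Real.pi, f (t * velocity k) := by
  rw [velocityLaw, integral_map (measurable_mul_velocity t).aemeasurable
    hf.aestronglyMeasurable, integral_smul_measure,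
    intervalIntegral.integral_of_le (by linarith [Real.pi_pos]),
    ENNReal.toReal_ofReal (by positivity)]

lemma velocity_add_pi (k : ℝ) : velocity (k + Real.pi) = -velocity k := by
  simp [velocity, neg_div]

lemma integral_sin_velocity (s : ℝ) :
    ∫ k in (-Real.pi)..Real.pi, Real.sin (s * velocity k) = 0 := by
  have hp : Function.Periodic (fun k ↦ Real.sin (s * velocity k)) (2 * Real.pi) := fun k ↦ by
    simp [two_mul, ← add_assoc, velocity_add_pi]
  have h1 := hp.intervalIntegral_add_eq (-Real.pi) 0
  have h2 : ∫ k in (-Real.pi)..Real.pi, Real.sin (s * velocity (k + Real.pi)) =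
      ∫ k in (0 : ℝ)..(2 * Real.pi), Real.sin (s * velocity k) := by
    rw [intervalIntegral.integral_comp_add_right fun k ↦ Real.sin (s * velocity k)]
    congr 1 <;> ring
  simp only [velocity_add_pi, mul_neg, Real.sin_neg, intervalIntegral.integral_neg] at h2
  rw [show -Real.pi + 2 * Real.pi = Real.pi by ring, zero_add] at h1
  linarith

lemma charFun_velocityLaw (t s : ℝ) :
    charFun (velocityLaw t) s =
      ((1 / (2 * Real.pi) * ∫ k in (-Real.pi)..Real.pi, Real.cos (s * (t * velocity k)) : ℝ) : ℂ)
      := by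
  have hv := continuous_velocity
  have h0 := integral_sin_velocity (s * t)
  rw [charFun_apply_real, integral_velocityLaw t (by fun_prop)]
  have e (k : ℝ) : Complex.exp (s * (t * velocity k : ℝ) * Complex.I) =
      (Real.cos (s * (t * velocity k)) : ℂ) + (Real.sin (s * t * velocity k) : ℂ) * Complex.I := by
    rw [Complex.exp_mul_I]
    push_cast
    rw [mul_assoc (s : ℂ)]
  simp only [e]
  rw [intervalIntegral.integral_add (Continuous.intervalIntegrable (by fun_prop) _ _)
    (Continuous.intervalIntegrable (by fun_prop) _ _), intervalIntegral.integral_mul_const,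
    intervalIntegral.integral_ofReal, intervalIntegral.integral_ofReal, h0, Complex.real_smul]
  push_cast
  ring

lemma tendsto_integral_walkLaw {m : ℕ → ℕ} {t : ℝ}
    (hm : Tendsto (fun n : ℕ ↦ (m n : ℝ) / n) atTop (𝓝 t))
    (f : BoundedContinuousFunction ℝ ℝ) :
    Tendsto (fun n ↦ ∫ x, f x ∂(walkLaw (m n) n)) atTop (𝓝 (∫ x, f x ∂(velocityLaw t))) := by
  have h : Tendsto (β := ProbabilityMeasure ℝ) (fun n ↦ ⟨walkLaw (m n) n, inferInstance⟩) atTop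
      (𝓝 (⟨velocityLaw t, inferInstance⟩ : ProbabilityMeasure ℝ)) := by
    refine ProbabilityMeasure.tendsto_iff_tendsto_charFun.2 fun s ↦ ?_
    simp only [ProbabilityMeasure.coe_mk, charFun_walkLaw, charFun_velocityLaw]
    refine (Complex.continuous_ofReal.tendsto _).comp (Tendsto.const_mul _ ?_)
    refine intervalIntegral.tendsto_integral_filter_of_dominated_convergence (fun _ ↦ 6)
      (.of_forall fun n ↦ (continuous_traceKernel _ _).aestronglyMeasurable)
      (.of_forall fun n ↦ ae_of_all _ fun k _ ↦ abs_traceKernel_le _ _ _)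
      intervalIntegrable_const (ae_of_all _ fun k _ ↦ tendsto_traceKernel hm s k)
  exact ProbabilityMeasure.tendsto_iff_forall_integral_tendsto.1 h f

lemma hasDerivAt_velocity (k : ℝ) :
    HasDerivAt velocity (-Real.sin k / ((1 + Real.cos k ^ 2) * Real.sqrt (1 + Real.cos k ^ 2))) k := by
  have hp : 0 < 1 + Real.cos k ^ 2 := by positivity
  have h1 : HasDerivAt (fun k ↦ 1 + Real.cos k ^ 2) (2 * Real.cos k * -Real.sin k) k := by
    simpa using ((Real.hasDerivAt_cos k).pow 2).const_add 1
  have h2 := (Real.hasDerivAt_cos k).div (h1.sqrt hp.ne') (by positivity)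
  convert! h2 using 1
  have hs : Real.sqrt (1 + Real.cos k ^ 2) ^ 2 = 1 + Real.cos k ^ 2 := Real.sq_sqrt hp.le
  have hs0 : Real.sqrt (1 + Real.cos k ^ 2) ≠ 0 := by positivity
  rw [hs]
  field_simp
  linear_combination Real.sin k * hs

lemma velocity_sq (k : ℝ) : velocity k ^ 2 = Real.cos k ^ 2 / (1 + Real.cos k ^ 2) := by
  rw [velocity, div_pow, Real.sq_sqrt (by positivity)]

lemma konno_velocity {k : ℝ} (hk : k ∈ Set.Ioo 0 Real.pi) :
    |-Real.sin k / ((1 + Real.cos k ^ 2) * Real.sqrt (1 + Real.cos k ^ 2))| * konno (velocity k) =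
      1 / Real.pi := by
  have hs := Real.sin_pos_of_mem_Ioo hk
  have hp : 0 < 1 + Real.cos k ^ 2 := by positivity
  have hv := velocity_sq k
  have hlt : |velocity k| < 1 / Real.sqrt 2 := by
    refine abs_lt_of_sq_lt_sq ?_ (by positivity)
    rw [hv, div_pow, Real.sq_sqrt (by norm_num), div_lt_div_iff₀ hp (by norm_num)]
    nlinarith [Real.sin_sq_add_cos_sq k]
  have h1 : 1 - 2 * velocity k ^ 2 = Real.sin k ^ 2 / (1 + Real.cos k ^ 2) := by
    rw [hv, Real.sin_sq]; field_simp; ring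
  have h2 : 1 - velocity k ^ 2 = 1 / (1 + Real.cos k ^ 2) := by
    rw [hv]; field_simp; ring
  rw [konno, if_pos hlt, h1, h2, Real.sqrt_div (sq_nonneg _), Real.sqrt_sq hs.le, abs_div,
    abs_neg, abs_of_pos hs, abs_of_pos (by positivity)]
  have : 0 < Real.sqrt (1 + Real.cos k ^ 2) := by positivity
  field_simp

lemma injOn_velocity : Set.InjOn velocity (Set.Ioo 0 Real.pi) := by
  refine (strictAntiOn_of_deriv_neg (convex_Icc 0 Real.pi) continuous_velocity.continuousOn
    fun k hk ↦ ?_).injOn.mono Set.Ioo_subset_Icc_self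
  rw [interior_Icc] at hk
  rw [(hasDerivAt_velocity k).deriv]
  have := Real.sin_pos_of_mem_Ioo hk
  exact div_neg_of_neg_of_pos (by linarith) (by positivity)

lemma konno_eq_zero_of_notMem_image {x : ℝ} (hx : x ∉ velocity '' Set.Ioo 0 Real.pi) :
    konno x = 0 := by
  rw [konno, if_neg]
  contrapose! hx
  refine intermediate_value_Ioo' Real.pi_pos.le continuous_velocity.continuousOn ?_
  have h0 : velocity 0 = 1 / Real.sqrt 2 := by norm_num [velocity]
  have h1 : velocity Real.pi = -(1 / Real.sqrt 2) := by
    rw [← h0, ← velocity_add_pi, zero_add]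
  rw [h0, h1]
  exact abs_lt.1 hx

lemma integral_velocityLaw_eq_konno (t : ℝ) {f : ℝ → ℝ} (hf : Continuous f) :
    ∫ x, f x ∂(velocityLaw t) = ∫ z, f (t * z) * konno z := by
  have hv := continuous_velocity
  have h1 : ∫ z, f (t * z) * konno z =
      ∫ k in Set.Ioo 0 Real.pi, 1 / Real.pi * f (t * velocity k) := by
    rw [← setIntegral_eq_integral_of_forall_compl_eq_zero
      (s := velocity '' Set.Ioo 0 Real.pi) fun z hz ↦ by
        rw [konno_eq_zero_of_notMem_image hz, mul_zero],
      integral_image_eq_integral_abs_deriv_smul measurableSet_Ioo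
        (fun k _ ↦ (hasDerivAt_velocity k).hasDerivWithinAt) injOn_velocity]
    refine setIntegral_congr_fun measurableSet_Ioo fun k hk ↦ ?_
    simp only [smul_eq_mul]
    rw [← konno_velocity hk]
    ring
  have hi (a b : ℝ) : IntervalIntegrable (fun k ↦ f (t * velocity k)) volume a b :=
    Continuous.intervalIntegrable (by fun_prop) _ _
  have h2 : ∫ k in (-Real.pi)..0, f (t * velocity k) = ∫ k in (0 : ℝ)..Real.pi, f (t * velocity k) := by
    have h := intervalIntegral.integral_comp_neg (a := 0) (b := Real.pi)
      fun k ↦ f (t * velocity k)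
    simp only [velocity, Real.cos_neg, neg_zero] at h ⊢
    exact h.symm
  rw [h1, integral_velocityLaw t hf, ← integral_Ioc_eq_integral_Ioo,
    ← intervalIntegral.integral_of_le Real.pi_pos.le, intervalIntegral.integral_const_mul,
    ← intervalIntegral.integral_add_adjacent_intervals (hi _ 0) (hi 0 _), h2, smul_eq_mul]
  field_simp
  ring

end Laws

section RiemannSums

open MeasureTheory

lemma integral_comp_floor {φ : ℤ → ℝ} (hφ : φ.support.Finite) :
    ∫ y : ℝ, φ ⌊y⌋ = ∑' j, φ j := by
  have e (y : ℝ) : φ ⌊y⌋ =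
      ∑ j ∈ hφ.toFinset, (Set.Ico (j : ℝ) (j + 1)).indicator (fun _ ↦ φ j) y := by
    simp only [Set.indicator_apply, ← Int.floor_eq_iff, Set.mem_Ico]
    by_cases h : φ ⌊y⌋ = 0 <;> simp [h]
  simp only [e]
  rw [integral_finsetSum, tsum_eq_sum (s := hφ.toFinset) fun j hj ↦ by simpa using hj]
  · refine Finset.sum_congr rfl fun j _ ↦ ?_
    rw [integral_indicator measurableSet_Ico]
    simp
  · intro j _
    rw [integrable_indicator_iff measurableSet_Ico]
    simp

lemma riemannSum_eq_integral {F : ℝ → ℝ} (hF : HasCompactSupport F) {n : ℕ} (hn : n ≠ 0) :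
    (1 / (n : ℝ)) * ∑' j : ℤ, F ((j : ℝ) / n) = ∫ x : ℝ, F ((⌊(n : ℝ) * x⌋ : ℝ) / n) := by
  have hn' : (n : ℝ) ≠ 0 := by exact_mod_cast hn
  have hfin : (Function.support fun j : ℤ ↦ F ((j : ℝ) / n)).Finite := by
    obtain ⟨R, hR⟩ := hF.isCompact.isBounded.subset_closedBall 0
    refine (Set.finite_Icc (-⌈R * n⌉) ⌈R * n⌉).subset fun j hj ↦ ?_
    have h := hR (subset_tsupport F hj)
    rw [mem_closedBall_zero_iff, Real.norm_eq_abs, abs_div, Nat.abs_cast,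
      div_le_iff₀ (by positivity)] at h
    rw [Set.mem_Icc, ← abs_le]
    have := h.trans (Int.le_ceil _)
    exact_mod_cast this
  have h := Measure.integral_comp_mul_left (fun y : ℝ ↦ F ((⌊y⌋ : ℝ) / n)) (n : ℝ)
  rw [h, integral_comp_floor hfin, abs_of_nonneg (by positivity), smul_eq_mul, one_div]

lemma tendsto_floor_mul_div (x : ℝ) :
    Tendsto (fun n : ℕ ↦ (⌊(n : ℝ) * x⌋ : ℝ) / n) atTop (𝓝 x) := by
  have h : Tendsto (fun n : ℕ ↦ x - (n : ℝ)⁻¹) atTop (𝓝 x) := by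
    simpa using tendsto_inv_atTop_nhds_zero_nat.const_sub x
  refine tendsto_of_tendsto_of_tendsto_of_le_of_le' h tendsto_const_nhds ?_ ?_ <;>
    filter_upwards [eventually_gt_atTop 0] with n hn
  · have hn' : (0 : ℝ) < n := by exact_mod_cast hn
    rw [le_div_iff₀ hn', sub_mul, inv_mul_cancel₀ hn'.ne']
    linarith [Int.lt_floor_add_one ((n : ℝ) * x)]
  · have hn' : (0 : ℝ) < n := by exact_mod_cast hn
    rw [div_le_iff₀ hn']
    linarith [Int.floor_le ((n : ℝ) * x)]

end RiemannSums

section Convergence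

open MeasureTheory

lemma integrable_comp_sub {γ : ℝ → ℝ} (hγ : Continuous γ) {C : ℝ} (hC : ∀ x, |γ x| ≤ C)
    (μ : Measure ℝ) [IsFiniteMeasure μ] (x : ℝ) : Integrable (fun w ↦ γ (x - w)) μ :=
  .of_bound (by fun_prop) C (ae_of_all _ fun w ↦ hC _)

/-- Convolutions of a uniformly continuous bounded function with weakly convergent laws converge
along convergent sequences of points. -/
lemma tendsto_integral_sub_of_tendsto {γ : ℝ → ℝ} (hγ : UniformContinuous γ) {C : ℝ}
    (hC : ∀ x, |γ x| ≤ C) {μ : ℕ → Measure ℝ} [∀ n, IsProbabilityMeasure (μ n)] {ν : Measure ℝ}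
    (hμ : ∀ f : BoundedContinuousFunction ℝ ℝ,
      Tendsto (fun n ↦ ∫ w, f w ∂(μ n)) atTop (𝓝 (∫ w, f w ∂ν)))
    {x : ℝ} {y : ℕ → ℝ} (hy : Tendsto y atTop (𝓝 x)) :
    Tendsto (fun n ↦ ∫ w, γ (y n - w) ∂(μ n)) atTop (𝓝 (∫ w, γ (x - w) ∂ν)) := by
  have hc := hγ.continuous
  have h1 : Tendsto (fun n ↦ ∫ w, γ (x - w) ∂(μ n)) atTop (𝓝 (∫ w, γ (x - w) ∂ν)) :=
    hμ (.ofNormedAddCommGroup (fun w ↦ γ (x - w)) (by fun_prop) C fun w ↦ hC _)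
  have h2 : Tendsto (fun n ↦ ∫ w, γ (y n - w) ∂(μ n) - ∫ w, γ (x - w) ∂(μ n)) atTop (𝓝 0) := by
    rw [Metric.tendsto_nhds]
    intro ε hε
    obtain ⟨δ, hδ, h⟩ := Metric.uniformContinuous_iff.1 hγ (ε / 2) (by positivity)
    filter_upwards [Metric.tendsto_nhds.1 hy δ hδ] with n hn
    rw [dist_zero_right, ← integral_sub (integrable_comp_sub hc hC _ _)
      (integrable_comp_sub hc hC _ _)]
    refine (norm_integral_le_of_norm_le_const (C := ε / 2) (ae_of_all _ fun w ↦ ?_)).trans_lt ?_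
    · rw [← dist_eq_norm]
      exact (h (by simpa using hn)).le
    · simpa using hε
  simpa using h2.add h1

lemma tendsto_riemannSum_convolution {γ H : ℝ → ℝ} (hγ : UniformContinuous γ) {C : ℝ}
    (hC : ∀ x, |γ x| ≤ C) (hH : Continuous H) (hHs : HasCompactSupport H)
    {μ : ℕ → Measure ℝ} [∀ n, IsProbabilityMeasure (μ n)] {ν : Measure ℝ}
    (hμ : ∀ f : BoundedContinuousFunction ℝ ℝ,
      Tendsto (fun n ↦ ∫ w, f w ∂(μ n)) atTop (𝓝 (∫ w, f w ∂ν))) :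
    Tendsto (fun n : ℕ ↦ (1 / (n : ℝ)) * ∑' j : ℤ, H ((j : ℝ) / n) *
      ∫ w, γ ((j : ℝ) / n - w) ∂(μ n)) atTop (𝓝 (∫ x, H x * ∫ w, γ (x - w) ∂ν)) := by
  have hc := hγ.continuous
  obtain ⟨M, hM⟩ := hHs.exists_bound_of_continuous hH
  obtain ⟨R, hR⟩ := hHs.isCompact.isBounded.subset_closedBall 0
  have hconv (n : ℕ) (x : ℝ) : |∫ w, γ (x - w) ∂(μ n)| ≤ C := by
    simpa using norm_integral_le_of_norm_le_const (μ := μ n) (f := fun w ↦ γ (x - w))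
      (ae_of_all _ fun w ↦ hC _)
  have hcont (n : ℕ) : Continuous fun x ↦ ∫ w, γ (x - w) ∂(μ n) :=
    continuous_of_dominated (fun x ↦ (integrable_comp_sub hc hC _ _).aestronglyMeasurable)
      (fun x ↦ ae_of_all _ fun w ↦ hC _) (integrable_const C) (ae_of_all _ fun w ↦ by fun_prop)
  have hlim : Tendsto (fun n : ℕ ↦ ∫ x : ℝ, H ((⌊(n : ℝ) * x⌋ : ℝ) / n) *
      ∫ w, γ ((⌊(n : ℝ) * x⌋ : ℝ) / n - w) ∂(μ n)) atTop
      (𝓝 (∫ x, H x * ∫ w, γ (x - w) ∂ν)) := by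
    refine tendsto_integral_filter_of_dominated_convergence
      ((Set.Icc (-(R + 1)) (R + 1)).indicator fun _ ↦ M * C) (.of_forall fun n ↦ ?_) ?_ ?_
      (ae_of_all _ fun x ↦ ?_)
    · refine Measurable.aestronglyMeasurable ?_
      exact (hH.mul (hcont n)).measurable.comp (by fun_prop)
    · filter_upwards [eventually_gt_atTop 0] with n hn
      refine ae_of_all _ fun x ↦ ?_
      have hn' : (0 : ℝ) < n := by exact_mod_cast hn
      by_cases hx : x ∈ Set.Icc (-(R + 1)) (R + 1)
      · rw [Set.indicator_of_mem hx, norm_mul]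
        exact mul_le_mul (hM _) (hconv _ _) (abs_nonneg _) ((norm_nonneg _).trans (hM 0))
      · rw [Set.indicator_of_notMem hx, norm_le_zero_iff, image_eq_zero_of_notMem_tsupport (f := H),
          zero_mul]
        contrapose! hx
        have h := hR hx
        rw [mem_closedBall_zero_iff, Real.norm_eq_abs, abs_le, le_div_iff₀ hn',
          div_le_iff₀ hn'] at h
        have h1 : (1 : ℝ) ≤ n := by exact_mod_cast hn
        have h2 := Int.lt_floor_add_one ((n : ℝ) * x)
        have h3 := Int.floor_le ((n : ℝ) * x)
        constructor <;> nlinarith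
    · rw [integrable_indicator_iff measurableSet_Icc]
      exact continuous_const.integrableOn_Icc
    · have hx := tendsto_floor_mul_div x
      exact ((hH.tendsto x).comp hx).mul (tendsto_integral_sub_of_tendsto hγ hC hμ hx)
  refine hlim.congr' ?_
  filter_upwards [eventually_ne_atTop 0] with n hn
  exact (riemannSum_eq_integral (F := fun x ↦ H x * ∫ w, γ (x - w) ∂(μ n)) hHs.mul_right hn).symm

lemma tsum_mul_walkProb (γ : ℝ → ℝ) (m n : ℕ) (j : ℤ) :
    ∑' k : ℤ, γ ((k : ℝ) / n) * walkProb m (j - k) =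
      ∫ w, γ ((j : ℝ) / n - w) ∂(walkLaw m n) := by
  rw [integral_walkLaw, ← (Equiv.subLeft j).tsum_eq, tsum_eq_sum (s := Finset.Icc (-(m : ℤ)) m)]
  · refine Finset.sum_congr rfl fun d _ ↦ ?_
    simp [sub_div, mul_comm]
  · intro d hd
    simp [walkProb_eq_zero hd]

lemma integral_mul_konno_eq (t : ℝ) (ht : 0 < t) {γ : ℝ → ℝ} (hγ : Continuous γ) (x : ℝ) :
    ∫ y : ℝ, γ y * ((1 / t) * konno ((x - y) / t)) = ∫ w, γ (x - w) ∂(velocityLaw t) := by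
  rw [integral_velocityLaw_eq_konno t (f := fun w ↦ γ (x - w)) (by fun_prop),
    ← integral_sub_left_eq_self _ volume x]
  have h := Measure.integral_comp_mul_left
    (fun y : ℝ ↦ γ (x - y) * ((1 / t) * konno ((x - (x - y)) / t))) t
  rw [abs_of_pos (by positivity), smul_eq_mul, inv_mul_eq_div, eq_div_iff ht.ne'] at h
  rw [← h, ← integral_mul_const]
  congr 1 with z
  rw [sub_sub_cancel, mul_div_cancel_left₀ _ ht.ne']
  field_simp

end Convergence

/-- **Mean convergence of the empirical density.**
Let `U` be the Hadamard quantum walk operator on `ℓ²(ℤ; ℂ²)` and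
`p_m(k,j) := ½‖(U^m(δ_k⊗+))(j)‖² + ½‖(U^m(δ_k⊗−))(j)‖²`. Let `γ : ℝ → ℝ` be continuous,
nonnegative, with compact support, `t > 0`, and `H : ℝ → ℝ` continuous with compact
support. Then `(1/n) Σ_{k∈ℤ} H(k/n) B(k,⌊tn⌋) → ∫ H(x) ρ(t,x) dx` as `n → ∞`, where
`B(j,m) := Σ_k γ(k/n) p_m(k,j)` and `ρ(t,x) = (γ * f_t)(x) = ∫ γ(y)(1/t)f((x−y)/t) dy`. -/
theorem mean_convergence_empirical_density
    (U : QWState →ₗ[ℂ] QWState)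
    (hU : ∀ (ψ : QWState) (k : ℤ),
      (U ψ) k 0 = (ψ (k - 1) 0 + ψ (k - 1) 1) / (Real.sqrt 2 : ℂ) ∧
      (U ψ) k 1 = (ψ (k + 1) 0 - ψ (k + 1) 1) / (Real.sqrt 2 : ℂ))
    (p : ℕ → ℤ → ℤ → ℝ)
    (hp : ∀ (m : ℕ) (k j : ℤ), p m k j =
      (1 / 2) * ‖((U ^ m) (deltaCoin k 0)) j‖ ^ 2
        + (1 / 2) * ‖((U ^ m) (deltaCoin k 1)) j‖ ^ 2)
    (γ : ℝ → ℝ) (hγcont : Continuous γ) (hγnonneg : ∀ y, 0 ≤ γ y)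
    (hγsupp : HasCompactSupport γ)
    (t : ℝ) (ht : 0 < t)
    (H : ℝ → ℝ) (hHcont : Continuous H) (hHsupp : HasCompactSupport H) :
    Tendsto
      (fun n : ℕ => (1 / (n : ℝ)) *
        ∑' j : ℤ, H ((j : ℝ) / (n : ℝ)) *
          (∑' k : ℤ, γ ((k : ℝ) / (n : ℝ)) * p ⌊t * (n : ℝ)⌋₊ k j))
      atTop
      (𝓝 (∫ x : ℝ, H x * ∫ y : ℝ, γ y * ((1 / t) * konno ((x - y) / t)))) := by
  obtain ⟨C, hC⟩ := hγsupp.exists_bound_of_continuous hγcont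
  have hm : Tendsto (fun n : ℕ ↦ (⌊t * (n : ℝ)⌋₊ : ℝ) / n) atTop (𝓝 t) :=
    (tendsto_nat_floor_mul_div_atTop ht.le).comp tendsto_natCast_atTop_atTop
  simp only [hp, transition_eq_walkProb hU, tsum_mul_walkProb, integral_mul_konno_eq t ht hγcont]
  exact tendsto_riemannSum_convolution (hγsupp.uniformContinuous_of_continuous hγcont) hC
    hHcont hHsupp (tendsto_integral_walkLaw hm)

end
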